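/- For every λ ∈ (0,1) and t > 0, the mean of the distribution p_{λ,t} equals e^{−(1−λ)t}; that is, Σ_{n≥0} n · p_{λ,t}(n) = e^{−(1−λ)t}. -/

import Mathlib

open Set Filter MeasureTheory

/-- Extinction-type parameter of the TKF91 model (deletion rate 1, insertion rate `lam`). -/
noncomputable def eta (lam t : ℝ) : ℝ :=
  (1 - Real.exp (-(1 - lam) * t)) / (1 - lam * Real.exp (-(1 - lam) * t))

/-- TKF91 mortal-link progeny-length pmf `p_{λ,t}`. -/
noncomputable def pTKF (lam t : ℝ) : ℕ → ℝ
  | 0 => eta lam t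
  | (n + 1) => (1 - eta lam t) * (1 - lam * eta lam t) * (lam * eta lam t) ^ n

/-- TKF91 immortal-link progeny pmf `q_{λ,t}`. -/
noncomputable def qTKF (lam t : ℝ) (n : ℕ) : ℝ :=
  (1 - lam * eta lam t) * (lam * eta lam t) ^ n

/-- pmf of `S_M(λ,t)`, a sum of `M` i.i.d. variables with law `p_{λ,t}`
(`M`-fold convolution of `pTKF lam t`). -/
noncomputable def pS (lam t : ℝ) : ℕ → ℕ → ℝ
  | 0 => fun n => if n = 0 then 1 else 0
  | (M + 1) => fun n => ∑ k ∈ Finset.range (n + 1), pS lam t M k * pTKF lam t (n - k)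

/-- pmf of the leaf sequence length `N = G + S_M(λ,t)` with `G ~ q_{λ,t}` independent. -/
noncomputable def pLeaf (lam t : ℝ) (M n : ℕ) : ℝ :=
  ∑ k ∈ Finset.range (n + 1), qTKF lam t k * pS lam t M (n - k)

/-- Joint distribution on `ℕ × ℕ` of the pair of leaf lengths of the two-leaf star tree
of height `h`, with stationary geometric root length. -/
noncomputable def Ldist (lam h : ℝ) (y : ℕ × ℕ) : ℝ :=
  ∑' M : ℕ, (1 - lam) * lam ^ M * (pLeaf lam h M y.1 * pLeaf lam h M y.2)

/-- Mean of `p_{λ,t}`. -/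
noncomputable def betaTKF (lam t : ℝ) : ℝ := Real.exp (-(1 - lam) * t)

/-- Standard deviation of `p_{λ,t}`. -/
noncomputable def sdev (lam t : ℝ) : ℝ :=
  Real.sqrt (∑' n : ℕ, ((n : ℝ) - betaTKF lam t) ^ 2 * pTKF lam t n)

/-- `P(S_M(λ,t) ∈ (a,b))`. -/
noncomputable def probIn (lam t : ℝ) (M : ℕ) (a b : ℝ) : ℝ :=
  ∑' j : ℕ, if (j : ℝ) ∈ Set.Ioo a b then pS lam t M j else 0

/-- CDF of `S_M(λ,t)`. -/
noncomputable def cdfS (lam t : ℝ) (M : ℕ) (x : ℝ) : ℝ :=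
  ∑' j : ℕ, if (j : ℝ) ≤ x then pS lam t M j else 0

/-- Standard normal CDF. -/
noncomputable def stdNormalCDF (x : ℝ) : ℝ :=
  ∫ u in Set.Iic x, Real.exp (-u ^ 2 / 2) / Real.sqrt (2 * Real.pi)

/-- The mean of `p_{λ,t}` equals `e^{-(1-λ)t}`. -/
theorem pTKF_mean (lam t : ℝ) (hlam : lam ∈ Set.Ioo (0 : ℝ) 1) (ht : 0 < t) :
    ∑' n : ℕ, (n : ℝ) * pTKF lam t n = Real.exp (-(1 - lam) * t) := by
  obtain ⟨h0, h1⟩ := hlam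
  have hE1 : Real.exp (-(1 - lam) * t) < 1 := by
    rw [Real.exp_lt_one_iff]
    nlinarith [mul_pos (sub_pos.2 h1) ht]
  have hE0 : 0 < Real.exp (-(1 - lam) * t) := Real.exp_pos _
  have hη : eta lam t =
    (1 - Real.exp (-(1 - lam) * t)) / (1 - lam * Real.exp (-(1 - lam) * t)) := rfl
  generalize Real.exp (-(1 - lam) * t) = x at *
  have hD : 0 < 1 - lam * x := by nlinarith
  have hD' := hD.ne'
  have hηpos : 0 < eta lam t := by
    rw [hη]; exact div_pos (by linarith) hD
  have e1 : 1 - eta lam t = x * (1 - lam) / (1 - lam * x) := by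
    rw [hη, eq_div_iff hD', sub_mul, div_mul_cancel₀ _ hD']; ring
  have e2 : 1 - lam * eta lam t = (1 - lam) / (1 - lam * x) := by
    rw [hη]; field_simp; ring
  have hr0 : 0 < lam * eta lam t := mul_pos h0 hηpos
  have hr1' : 0 < 1 - lam * eta lam t := by
    rw [e2]; exact div_pos (by linarith) hD
  have hr : ‖lam * eta lam t‖ < 1 := by
    rw [Real.norm_of_nonneg hr0.le]; linarith
  have hs := (hasSum_coe_mul_geometric_of_norm_lt_one hr).mul_left
    ((1 - eta lam t) * (1 - lam * eta lam t) / (lam * eta lam t))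
  have hx : 1 - eta lam t = x * (1 - lam * eta lam t) := by
    rw [e1, e2]; ring
  have hval : (1 - eta lam t) * (1 - lam * eta lam t) / (lam * eta lam t) *
      (lam * eta lam t / (1 - lam * eta lam t) ^ 2) = x := by
    rw [hx]
    generalize lam * eta lam t = r at *
    have := hr0.ne'
    have := hr1'.ne'
    field_simp
  rw [hval] at hs
  rw [← hs.tsum_eq]
  refine tsum_congr fun n => ?_
  cases n with
  | zero => simp
  | succ n =>
    simp only [pTKF]
    generalize lam * eta lam t = r at *
    have := hr0.ne'
    field_simp
    ring
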